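/- 3F2(1/2, 1/4, 3/4; 1, 1; 1) = √2 · 3F2(1/2, 1/2, 1/2; 1, 1; −1). -/

import Mathlib

open Real

/-- Ascending Pochhammer symbol `(x)_k = x(x+1)⋯(x+k−1)`. -/
noncomputable def poch (x : ℝ) (k : ℕ) : ℝ := (ascPochhammer ℝ k).eval x

/-- The Beta function quotient `B(x,y) = Γ(x)Γ(y)/Γ(x+y)`. -/
noncomputable def betaR (x y : ℝ) : ℝ := Gamma x * Gamma y / Gamma (x + y)

/-- Generalized hypergeometric series `₃F₂(a₁,a₂,a₃; b₁,b₂; z)`. -/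
noncomputable def F32 (a1 a2 a3 b1 b2 z : ℝ) : ℝ :=
  ∑' k : ℕ, (poch a1 k * poch a2 k * poch a3 k)
      / (poch b1 k * poch b2 k * (k.factorial : ℝ)) * z ^ k

/-- The hypergeometric period value `P(r,s) = π · B(r, s−r) · ₃F₂(1/2,1/2,r; 1,s; 1)`. -/
noncomputable def P (r s : ℝ) : ℝ := π * betaR r (s - r) * F32 (1/2) (1/2) r 1 s 1

lemma poch_zero (x : ℝ) : poch x 0 = 1 := by simp [poch]

lemma poch_succ (x : ℝ) (k : ℕ) : poch x (k + 1) = poch x k * (x + k) := by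
  simp [poch, ascPochhammer_succ_eval]

lemma poch_pos {x : ℝ} (hx : 0 < x) (k : ℕ) : 0 < poch x k := ascPochhammer_pos k x hx

lemma poch_one (k : ℕ) : poch 1 k = k.factorial := by
  simp [poch]

lemma poch_add (x : ℝ) (m k : ℕ) : poch x (m + k) = poch x m * poch (x + m) k := by
  induction k with
  | zero => simp [poch_zero]
  | succ k ih =>
    rw [← add_assoc, poch_succ, poch_succ, ih]
    push_cast
    ring

lemma poch_half_double (k : ℕ) :
    poch (1 / 2) (2 * k) = 4 ^ k * poch (1 / 4) k * poch (3 / 4) k := by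
  induction k with
  | zero => simp [poch_zero]
  | succ k ih =>
    rw [show 2 * (k + 1) = 2 * k + 1 + 1 by ring, poch_succ, poch_succ, ih, poch_succ, poch_succ]
    push_cast
    ring

/-- The summand of the balanced terminating series
`₃F₂(-n, n + 1/2, 1/2; 1, 1; 1)`, up to normalization. -/
noncomputable def saalTerm (n k : ℕ) : ℝ :=
  (-1) ^ k * poch (1 / 2) k * poch (1 / 2) (n + k) /
    ((k.factorial : ℝ) ^ 3 * ((n - k).factorial : ℝ))

/-- Telescoping form of the first-order recurrence in `n` for `∑ k, saalTerm n k`. -/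
lemma sum_saalTerm_telescope (n m : ℕ) (hm : m ≤ n) :
    ∑ k ∈ Finset.range (m + 1),
      (((n : ℝ) + 1) ^ 3 * saalTerm (n + 1) k - ((n : ℝ) + 1 / 2) ^ 3 * saalTerm n k) =
    (2 * n + 3 / 2) * (m + 1 / 2) * (n + m + 1 / 2) * saalTerm n m := by
  induction m with
  | zero =>
    simp only [zero_add, Finset.sum_range_one, saalTerm, add_zero, Nat.sub_zero, poch_succ,
      Nat.factorial_succ, poch_zero]
    push_cast
    field_simp
    ring
  | succ m ih =>
    rw [Finset.sum_range_succ, ih (by omega)]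
    obtain ⟨j, rfl⟩ := Nat.exists_eq_add_of_le hm
    simp only [saalTerm]
    rw [show m + 1 + j - m = j + 1 by omega, show m + 1 + j - (m + 1) = j by omega,
      show m + 1 + j + 1 - (m + 1) = j + 1 by omega,
      show m + 1 + j + 1 + (m + 1) = m + 1 + j + m + 1 + 1 by omega,
      show m + 1 + j + (m + 1) = m + 1 + j + m + 1 by omega]
    simp only [poch_succ _ (m + 1 + j + m + 1), poch_succ _ (m + 1 + j + m), poch_succ _ m,
      Nat.factorial_succ, pow_succ (-1 : ℝ) m]
    push_cast
    field_simp
    ring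

lemma sum_saalTerm_succ (n : ℕ) :
    ((n : ℝ) + 1) ^ 3 * ∑ k ∈ Finset.range (n + 1 + 1), saalTerm (n + 1) k =
      ((n : ℝ) + 1 / 2) ^ 3 * ∑ k ∈ Finset.range (n + 1), saalTerm n k := by
  have h := sum_saalTerm_telescope n n le_rfl
  rw [Finset.sum_sub_distrib, ← Finset.mul_sum, ← Finset.mul_sum] at h
  have h2 : ((n : ℝ) + 1) ^ 3 * saalTerm (n + 1) (n + 1) =
      -((2 * n + 3 / 2) * (n + 1 / 2) * (n + n + 1 / 2) * saalTerm n n) := by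
    simp only [saalTerm]
    rw [show n + 1 + (n + 1) = n + n + 1 + 1 by omega, Nat.sub_self, Nat.sub_self]
    simp only [poch_succ, Nat.factorial_succ, pow_succ (-1 : ℝ) n]
    push_cast
    field_simp
    ring
  rw [Finset.sum_range_succ, mul_add]
  linarith

lemma sum_saalTerm (n : ℕ) :
    ∑ k ∈ Finset.range (n + 1), saalTerm n k = poch (1 / 2) n ^ 3 / (n.factorial : ℝ) ^ 3 := by
  induction n with
  | zero => simp [saalTerm, poch_zero]
  | succ n ih =>
    have h := sum_saalTerm_succ n
    rw [ih] at h
    rw [poch_succ, Nat.factorial_succ, ← mul_right_inj' (show ((n : ℝ) + 1) ^ 3 ≠ 0 by positivity),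
      h]
    push_cast
    field_simp
    ring

/-- The coefficients of `₃F₂(1/2, 1/4, 3/4; 1, 1; z)`. -/
noncomputable def quarterCoeff (k : ℕ) : ℝ :=
  poch (1 / 2) k * poch (1 / 4) k * poch (3 / 4) k / (k.factorial : ℝ) ^ 3

/-- The coefficients of `₃F₂(1/2, 1/2, 1/2; 1, 1; z)`. -/
noncomputable def halfCoeff (k : ℕ) : ℝ := poch (1 / 2) k ^ 3 / (k.factorial : ℝ) ^ 3

lemma saalTerm_add (k m : ℕ) :
    saalTerm (k + m) k =
      quarterCoeff k * (-4) ^ k * (poch (1 / 2 + 2 * k) m / (m.factorial : ℝ)) := by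
  have h := poch_add (1 / 2) (2 * k) m
  rw [poch_half_double] at h
  rw [saalTerm, quarterCoeff, show k + m + k = 2 * k + m by ring, h, Nat.add_sub_cancel_left,
    neg_pow (4 : ℝ) k]
  push_cast
  field_simp

lemma quarterCoeff_pos (k : ℕ) : 0 < quarterCoeff k := by
  have h1 := poch_pos (x := 1 / 2) (by norm_num) k
  have h2 := poch_pos (x := 1 / 4) (by norm_num) k
  have h3 := poch_pos (x := 3 / 4) (by norm_num) k
  unfold quarterCoeff
  positivity

lemma halfCoeff_pos (k : ℕ) : 0 < halfCoeff k := by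
  have h1 := poch_pos (x := 1 / 2) (by norm_num) k
  unfold halfCoeff
  positivity

lemma halfCoeff_succ (k : ℕ) :
    halfCoeff (k + 1) = halfCoeff k * ((k + 1 / 2) ^ 3 / (k + 1) ^ 3) := by
  simp only [halfCoeff, poch_succ, Nat.factorial_succ]
  push_cast
  field_simp
  ring

lemma quarterCoeff_le_halfCoeff (k : ℕ) : quarterCoeff k ≤ halfCoeff k := by
  have h : poch (1 / 4) k * poch (3 / 4) k ≤ poch (1 / 2) k ^ 2 := by
    induction k with
    | zero => simp [poch_zero]
    | succ k ih =>
      simp only [poch_succ]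
      have : (1 / 4 + (k : ℝ)) * (3 / 4 + k) ≤ (1 / 2 + k) ^ 2 := by nlinarith
      calc _ = (poch (1 / 4) k * poch (3 / 4) k) * ((1 / 4 + (k : ℝ)) * (3 / 4 + k)) := by ring
        _ ≤ poch (1 / 2) k ^ 2 * (1 / 2 + k) ^ 2 := by gcongr
        _ = _ := by ring
  have h1 := poch_pos (x := 1 / 2) (by norm_num) k
  unfold quarterCoeff halfCoeff
  gcongr
  rw [mul_assoc, pow_succ' _ 2]
  gcongr

lemma halfCoeff_sq_mul_le (k : ℕ) : halfCoeff k ^ 2 * ((k : ℝ) + 1) ^ 3 ≤ 1 := by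
  induction k with
  | zero => simp [halfCoeff, poch_zero]
  | succ k ih =>
    refine le_trans ?_ ih
    rw [halfCoeff_succ]
    have : ((k : ℝ) + 1 / 2) ^ 2 * (k + 2) ≤ (k + 1) ^ 3 := by
      have : (0 : ℝ) ≤ k := k.cast_nonneg
      nlinarith
    calc (halfCoeff k * (((k : ℝ) + 1 / 2) ^ 3 / (k + 1) ^ 3)) ^ 2 * (((k + 1 : ℕ) : ℝ) + 1) ^ 3
        = halfCoeff k ^ 2 * ((((k : ℝ) + 1 / 2) ^ 2 * (k + 2)) ^ 3 / (k + 1) ^ 6) := by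
          push_cast
          field_simp
          ring
      _ ≤ halfCoeff k ^ 2 * ((((k : ℝ) + 1) ^ 3) ^ 3 / (k + 1) ^ 6) := by gcongr
      _ = halfCoeff k ^ 2 * ((k : ℝ) + 1) ^ 3 := by
          field_simp

lemma halfCoeff_le_rpow (k : ℕ) : halfCoeff k ≤ 1 / ((k + 1 : ℕ) : ℝ) ^ (3 / 2 : ℝ) := by
  have hk : (0 : ℝ) < k + 1 := by positivity
  push_cast
  rw [le_div_iff₀ (by positivity)]
  have h := halfCoeff_sq_mul_le k
  have h2 : (((k : ℝ) + 1) ^ (3 / 2 : ℝ)) ^ 2 = ((k : ℝ) + 1) ^ 3 := by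
    rw [← Real.rpow_natCast, ← Real.rpow_mul hk.le, ← Real.rpow_natCast]
    norm_num
  rw [← h2, ← mul_pow] at h
  exact (pow_le_one_iff_of_nonneg (mul_nonneg (halfCoeff_pos k).le (by positivity)) two_ne_zero).1 h

lemma summable_halfCoeff : Summable halfCoeff := by
  have h : Summable fun n : ℕ => 1 / (n : ℝ) ^ (3 / 2 : ℝ) :=
    Real.summable_one_div_nat_rpow.2 (by norm_num)
  exact ((summable_nat_add_iff 1).2 h).of_nonneg_of_le (fun k => (halfCoeff_pos k).le)
    halfCoeff_le_rpow

lemma summable_quarterCoeff : Summable quarterCoeff :=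
  summable_halfCoeff.of_nonneg_of_le (fun k => (quarterCoeff_pos k).le) quarterCoeff_le_halfCoeff

lemma hasSum_poch_mul_pow (a : ℝ) {z : ℝ} (hz : |z| < 1) :
    HasSum (fun m : ℕ => poch a m / (m.factorial : ℝ) * z ^ m) ((1 - z) ^ (-a)) := by
  have h := (Real.one_div_one_sub_rpow_hasFPowerSeriesOnBall_zero a).hasSum
    (y := z) (by simpa [Metric.mem_eball, edist_dist, Real.dist_eq] using hz)
  have hc (m : ℕ) : Ring.choose (a + m - 1) m = poch a m / (m.factorial : ℝ) := by
    rw [← Ring.multichoose_eq, eq_div_iff (by positivity), mul_comm, ← nsmul_eq_mul,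
      Ring.factorial_nsmul_multichoose_eq_ascPochhammer, Polynomial.ascPochhammer_smeval_eq_eval,
      poch]
  simpa [FormalMultilinearSeries.ofScalars_apply_eq, hc, Real.rpow_neg, (abs_lt.1 hz).2.le, mul_comm]
    using h

lemma one_sub_rpow_neg_half_sub {z : ℝ} (hz : z < 1) (k : ℕ) :
    (1 - z) ^ (-(1 / 2 + 2 * k : ℝ)) = (1 - z) ^ (-(1 / 2) : ℝ) * (1 / (1 - z) ^ 2) ^ k := by
  have h : 0 < 1 - z := by linarith
  rw [neg_add, Real.rpow_add h, Real.rpow_neg h.le (2 * k), one_div ((1 - z) ^ 2), inv_pow,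
    ← pow_mul, ← Real.rpow_natCast _ (2 * k)]
  push_cast
  rfl

lemma hasSum_saalTerm_mul_pow (k : ℕ) {z : ℝ} (hz : |z| < 1) :
    HasSum (fun m : ℕ => saalTerm (k + m) k * z ^ (k + m))
      ((1 - z) ^ (-(1 / 2) : ℝ) * (quarterCoeff k * (-4 * z / (1 - z) ^ 2) ^ k)) := by
  have h := (hasSum_poch_mul_pow (1 / 2 + 2 * k) hz).mul_left (quarterCoeff k * (-4 * z) ^ k)
  rw [one_sub_rpow_neg_half_sub (abs_lt.1 hz).2] at h
  have hv : (1 - z) ^ (-(1 / 2) : ℝ) * (quarterCoeff k * (-4 * z / (1 - z) ^ 2) ^ k) =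
      quarterCoeff k * (-4 * z) ^ k *
        ((1 - z) ^ (-(1 / 2) : ℝ) * (1 / (1 - z) ^ 2) ^ k) := by
    rw [div_eq_mul_one_div (-4 * z), mul_pow _ (1 / (1 - z) ^ 2)]
    ring
  have hf : (fun m : ℕ => saalTerm (k + m) k * z ^ (k + m)) = fun m : ℕ =>
      quarterCoeff k * (-4 * z) ^ k *
        (poch (1 / 2 + 2 * k) m / (m.factorial : ℝ) * z ^ m) := by
    funext m
    rw [saalTerm_add, mul_pow, pow_add]
    ring
  rwa [hv, hf]

lemma abs_saalTerm_mul_pow (k m : ℕ) (z : ℝ) :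
    |saalTerm (k + m) k * z ^ (k + m)| = (-1) ^ k * (saalTerm (k + m) k * |z| ^ (k + m)) := by
  have h1 := poch_pos (x := 1 / 2) (by norm_num) k
  have h2 := poch_pos (x := 1 / 2) (by norm_num) (k + m + k)
  have h : saalTerm (k + m) k = (-1) ^ k * |saalTerm (k + m) k| := by
    rw [saalTerm, mul_assoc, mul_div_assoc, abs_mul, abs_pow, abs_neg, abs_one, one_pow, one_mul,
      abs_of_pos (by positivity)]
  rw [abs_mul, abs_pow]
  nth_rw 2 [h]
  rw [← mul_assoc, ← mul_assoc, ← mul_pow]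
  simp

lemma summable_saalTerm_mul_pow {z : ℝ} (hz : |z| ≤ 1 / 10) :
    Summable fun p : ℕ × ℕ => saalTerm (p.1 + p.2) p.1 * z ^ (p.1 + p.2) := by
  have hz' : |(|z|)| < 1 := by rw [abs_abs]; linarith
  have hs (k : ℕ) := (hasSum_saalTerm_mul_pow k hz').mul_left ((-1) ^ k)
  refine Summable.of_norm ((summable_prod_of_nonneg fun _ => norm_nonneg _).2 ?_)
  simp only [Real.norm_eq_abs, abs_saalTerm_mul_pow]
  refine ⟨fun k => (hs k).summable, ?_⟩
  simp only [fun k => (hs k).tsum_eq]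
  refine (summable_quarterCoeff.mul_left ((1 - |z|) ^ (-(1 / 2) : ℝ))).of_norm_bounded fun k => ?_
  have h1 : 0 < 1 - |z| := by linarith
  have hle : |-4 * |z| / (1 - |z|) ^ 2| ≤ 1 := by
    rw [abs_div, abs_mul, abs_abs, abs_of_pos (pow_pos h1 2), div_le_one (by positivity)]
    norm_num
    nlinarith [abs_nonneg z]
  rw [Real.norm_eq_abs, abs_mul, abs_mul, abs_mul, abs_pow, abs_pow, abs_neg, abs_one, one_pow,
    one_mul, abs_of_pos (quarterCoeff_pos k), abs_of_pos (by positivity)]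
  exact mul_le_mul_of_nonneg_left
    (mul_le_of_le_one_right (quarterCoeff_pos k).le (pow_le_one₀ (abs_nonneg _) hle))
    (by positivity)

/-- Whipple's quadratic transformation of `₃F₂(1/2, 1/2, 1/2; 1, 1; z)` near the origin. -/
lemma tsum_halfCoeff_eq_of_small {z : ℝ} (hz : |z| ≤ 1 / 10) :
    ∑' n, halfCoeff n * z ^ n =
      (1 - z) ^ (-(1 / 2) : ℝ) * ∑' k, quarterCoeff k * (-4 * z / (1 - z) ^ 2) ^ k := by
  have hf := summable_saalTerm_mul_pow hz
  have hs (k : ℕ) := hasSum_saalTerm_mul_pow k (z := z) (by linarith)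
  have h1 := hf.tsum_prod' fun k => (hs k).summable
  simp only [fun k => (hs k).tsum_eq, tsum_mul_left] at h1
  have hf' := Finset.HasAntidiagonal.sigmaAntidiagonalEquivProd.summable_iff.2 hf
  simp only [Function.comp_def] at hf'
  rw [← h1, ← Finset.HasAntidiagonal.sigmaAntidiagonalEquivProd.tsum_eq,
    Summable.tsum_sigma' (fun n => (hasSum_fintype _).summable) hf']
  refine tsum_congr fun n => ?_
  rw [tsum_fintype, Finset.univ_eq_attach,
    Finset.sum_congr rfl (g := fun p => saalTerm n p.1.1 * z ^ n),
    Finset.sum_attach (Finset.HasAntidiagonal.antidiagonal n) (fun p => saalTerm n p.1 * z ^ n),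
    Finset.Nat.sum_antidiagonal_eq_sum_range_succ (fun k _ => saalTerm n k * z ^ n),
    ← Finset.sum_mul, sum_saalTerm, halfCoeff]
  rintro ⟨p, hp⟩ -
  simp [Finset.HasAntidiagonal.sigmaAntidiagonalEquivProd, Finset.HasAntidiagonal.mem_antidiagonal.1 hp]

lemma analyticOnNhd_tsum_mul_pow {c : ℕ → ℝ} (hc : Summable c) (hc0 : ∀ n, 0 ≤ c n) :
    AnalyticOnNhd ℝ (fun x : ℝ => ∑' n, c n * x ^ n) (Set.Ioo (-1) 1) := by
  have hr : 1 ≤ (FormalMultilinearSeries.ofScalars ℝ c).radius := by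
    refine FormalMultilinearSeries.le_radius_of_bound _ (∑' n, c n) (r := 1) fun n => ?_
    simpa [FormalMultilinearSeries.ofScalars_norm, abs_of_nonneg (hc0 n)] using
      hc.le_tsum n fun j _ => hc0 j
  have h := ((FormalMultilinearSeries.ofScalars ℝ c).hasFPowerSeriesOnBall
    (zero_lt_one.trans_le hr)).analyticOnNhd
  have he : (FormalMultilinearSeries.ofScalars ℝ c).sum = fun x : ℝ => ∑' n, c n * x ^ n := 
    FormalMultilinearSeries.ofScalarsSum_eq_tsum (E := ℝ) c
  rw [he] at h
  refine h.mono fun x hx => lt_of_lt_of_le ?_ hr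
  simpa [edist_dist, Real.dist_eq, abs_lt] using hx

lemma continuousOn_tsum_mul_pow {c : ℕ → ℝ} (hc : Summable c) (hc0 : ∀ n, 0 ≤ c n) :
    ContinuousOn (fun x : ℝ => ∑' n, c n * x ^ n) (Set.Icc (-1) 1) := by
  refine continuousOn_tsum (fun n => by fun_prop) hc fun n x hx => ?_
  rw [norm_mul, norm_pow, Real.norm_of_nonneg (hc0 n)]
  exact mul_le_of_le_one_right (hc0 n) (pow_le_one₀ (norm_nonneg _) (abs_le.2 hx))

lemma neg_four_mul_div_mem_Ioo {z : ℝ} (hz : z ∈ Set.Ioo (-1 : ℝ) (1 / 10)) :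
    -4 * z / (1 - z) ^ 2 ∈ Set.Ioo (-1 : ℝ) 1 := by
  obtain ⟨h1, h2⟩ := hz
  have h : 0 < (1 - z) ^ 2 := by nlinarith
  rw [Set.mem_Ioo, lt_div_iff₀ h, div_lt_one h]
  constructor <;> nlinarith

lemma tsum_halfCoeff_eqOn_Ioo :
    Set.EqOn (fun z : ℝ => ∑' n, halfCoeff n * z ^ n)
      (fun z => (1 - z) ^ (-(1 / 2) : ℝ) * ∑' k, quarterCoeff k * (-4 * z / (1 - z) ^ 2) ^ k)
      (Set.Ioo (-1) (1 / 10)) := by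
  refine AnalyticOnNhd.eqOn_of_preconnected_of_eventuallyEq (𝕜 := ℝ) (z₀ := 0)
    ((analyticOnNhd_tsum_mul_pow summable_halfCoeff fun n => (halfCoeff_pos n).le).mono
      (Set.Ioo_subset_Ioo_right (by norm_num))) (fun z hz => ?_) isPreconnected_Ioo
    (by norm_num) ?_
  · have h1 : 0 < 1 - z := by linarith [hz.2]
    have hq : AnalyticAt ℝ (fun z : ℝ => -4 * z / (1 - z) ^ 2) z := by
      fun_prop (disch := positivity)
    have hp : AnalyticAt ℝ (fun z : ℝ => (1 - z) ^ (-(1 / 2) : ℝ)) z := by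
      have : AnalyticAt ℝ (fun z : ℝ => 1 - z) z := by fun_prop
      refine (((this.log h1).mul (analyticAt_const (v := -(1 / 2)))).rexp).congr ?_
      filter_upwards [eventually_lt_nhds (show z < 1 by linarith)] with y hy
      rw [Real.rpow_def_of_pos (by linarith)]
      rfl
    exact hp.mul (AnalyticAt.fun_comp (f := fun z : ℝ => -4 * z / (1 - z) ^ 2) (analyticOnNhd_tsum_mul_pow summable_quarterCoeff
      (fun n => (quarterCoeff_pos n).le) _ (neg_four_mul_div_mem_Ioo hz)) hq)
  · filter_upwards [Metric.closedBall_mem_nhds (0 : ℝ) (show (0 : ℝ) < 1 / 10 by norm_num)]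
      with z hz
    exact tsum_halfCoeff_eq_of_small (by simpa using hz)

lemma tsum_halfCoeff_neg_one :
    ∑' n, halfCoeff n * (-1) ^ n = 2 ^ (-(1 / 2) : ℝ) * ∑' k, quarterCoeff k * 1 ^ k := by
  have hmaps : Set.MapsTo (fun z : ℝ => -4 * z / (1 - z) ^ 2) (Set.Ico (-1) (1 / 10))
      (Set.Icc (-1) 1) := by
    intro z hz
    rcases hz.1.eq_or_lt with rfl | h
    · norm_num
    · exact Set.Ioo_subset_Icc_self (neg_four_mul_div_mem_Ioo ⟨h, hz.2⟩)
  have hne : ∀ z ∈ Set.Ico (-1 : ℝ) (1 / 10), 1 - z ≠ 0 := fun z hz => by linarith [hz.2]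
  have h := tsum_halfCoeff_eqOn_Ioo.of_subset_closure (t := Set.Ico (-1) (1 / 10))
    ((continuousOn_tsum_mul_pow summable_halfCoeff fun n => (halfCoeff_pos n).le).mono
      fun z hz => ⟨hz.1, by linarith [hz.2]⟩)
    (ContinuousOn.mul
      (ContinuousOn.rpow_const (by fun_prop) fun z hz => Or.inl (hne z hz))
      ((continuousOn_tsum_mul_pow summable_quarterCoeff fun n => (quarterCoeff_pos n).le).comp
        (ContinuousOn.div (by fun_prop) (by fun_prop) fun z hz => pow_ne_zero 2 (hne z hz)) hmaps))
    Set.Ioo_subset_Ico_self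
    (by rw [closure_Ioo (by norm_num)]; exact Set.Ico_subset_Icc_self)
    (show (-1 : ℝ) ∈ Set.Ico (-1 : ℝ) (1 / 10) by norm_num)
  norm_num at h ⊢
  exact h

/-- Quadratic transformation evaluation:
`₃F₂(1/2,1/4,3/4;1,1;1) = √2 · ₃F₂(1/2,1/2,1/2;1,1;−1)`. -/
theorem F32_quadratic_relation :
    F32 (1/2) (1/4) (3/4) 1 1 1 = Real.sqrt 2 * F32 (1/2) (1/2) (1/2) 1 1 (-1) := by
  have h1 : F32 (1/2) (1/4) (3/4) 1 1 1 = ∑' k, quarterCoeff k * 1 ^ k := by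
    refine tsum_congr fun k => ?_
    rw [poch_one, quarterCoeff]
    ring
  have h2 : F32 (1/2) (1/2) (1/2) 1 1 (-1) = ∑' n, halfCoeff n * (-1) ^ n := by
    refine tsum_congr fun k => ?_
    rw [poch_one, halfCoeff]
    ring
  rw [h1, h2, tsum_halfCoeff_neg_one, ← mul_assoc, Real.sqrt_eq_rpow, ← Real.rpow_add two_pos]
  norm_num
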